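/- For the channel with parameters n11 = 10, n22 = 20, n12 = 6, n21 = 12, channel-output feedback never increases the sum-rate: for all nonnegative integers l11 and l22, Σ(10, 20, 6, 12, l11, l22) = 0. -/

import Mathlib

noncomputable section

/-- Positive part of an integer: `x⁺ = max(x, 0)`. -/
def pp (x : ℤ) : ℤ := max x 0

/-- Feedback correction term `a_j` for index `j`, where `njj, nji, nij, ljj`
are the channel parameters `n_jj, n_ji, n_ij, l_jj` (as integers). -/
def corr (njj nji nij ljj : ℤ) : ℤ :=
  pp (pp (min ljj (max njj nji) - pp (njj - nji)) - pp (nji - njj)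
      - min njj nij + min (pp (njj - nji)) nij)

/-- Capacity region `C(n11, n22, n12, n21, l11, l22)` of the two-user linear
deterministic interference channel with noisy channel-output feedback, as a
subset of `ℝ²` (pairs `(R1, R2)`). -/
def capRegion (n11 n22 n12 n21 l11 l22 : ℕ) : Set (ℝ × ℝ) :=
  {p : ℝ × ℝ | 0 ≤ p.1 ∧ 0 ≤ p.2 ∧
    -- (1) for (i,j) = (1,2) and (2,1)
    p.1 ≤ ((min (max (n11 : ℤ) (n21 : ℤ)) (max (n11 : ℤ) (n12 : ℤ))) : ℝ) ∧
    p.2 ≤ ((min (max (n22 : ℤ) (n12 : ℤ)) (max (n22 : ℤ) (n21 : ℤ))) : ℝ) ∧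
    -- (2) for (i,j) = (1,2) and (2,1)
    p.1 ≤ ((min (max (n11 : ℤ) (n21 : ℤ))
              (max (n11 : ℤ) ((l22 : ℤ) - pp ((n22 : ℤ) - (n21 : ℤ))))) : ℝ) ∧
    p.2 ≤ ((min (max (n22 : ℤ) (n12 : ℤ))
              (max (n22 : ℤ) ((l11 : ℤ) - pp ((n11 : ℤ) - (n12 : ℤ))))) : ℝ) ∧
    -- (3)
    p.1 + p.2 ≤ ((min (max (n11 : ℤ) (n12 : ℤ) + pp ((n22 : ℤ) - (n12 : ℤ)))
                      (max (n22 : ℤ) (n21 : ℤ) + pp ((n11 : ℤ) - (n21 : ℤ)))) : ℝ) ∧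
    -- (4)
    p.1 + p.2 ≤ ((max (pp ((n11 : ℤ) - (n12 : ℤ))) (n21 : ℤ)
                  + max (pp ((n22 : ℤ) - (n21 : ℤ))) (n12 : ℤ)
                  + corr (n11 : ℤ) (n12 : ℤ) (n21 : ℤ) (l11 : ℤ)
                  + corr (n22 : ℤ) (n21 : ℤ) (n12 : ℤ) (l22 : ℤ)) : ℝ) ∧
    -- (5) for (i,j) = (1,2) and (2,1)
    2 * p.1 + p.2 ≤ ((max (n22 : ℤ) (n21 : ℤ) + max (n11 : ℤ) (n12 : ℤ)
                  + pp ((n11 : ℤ) - (n21 : ℤ))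
                  - min (pp ((n22 : ℤ) - (n21 : ℤ))) (n12 : ℤ)
                  + corr (n22 : ℤ) (n21 : ℤ) (n12 : ℤ) (l22 : ℤ)) : ℝ) ∧
    2 * p.2 + p.1 ≤ ((max (n11 : ℤ) (n12 : ℤ) + max (n22 : ℤ) (n21 : ℤ)
                  + pp ((n22 : ℤ) - (n12 : ℤ))
                  - min (pp ((n11 : ℤ) - (n12 : ℤ))) (n21 : ℤ)
                  + corr (n11 : ℤ) (n12 : ℤ) (n21 : ℤ) (l11 : ℤ)) : ℝ)}

/-- Maximum individual-rate improvement `Δ_1` of user 1 due to feedback. -/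
def Delta1 (n11 n22 n12 n21 l11 l22 : ℕ) : ℝ :=
  sSup ((fun R2 : ℝ =>
    sSup {R1 : ℝ | (R1, R2) ∈ capRegion n11 n22 n12 n21 l11 l22} -
    sSup {R1 : ℝ | (R1, R2) ∈ capRegion n11 n22 n12 n21 0 0}) '' {R2 : ℝ | 0 < R2})

/-- Maximum individual-rate improvement `Δ_2` of user 2 due to feedback. -/
def Delta2 (n11 n22 n12 n21 l11 l22 : ℕ) : ℝ :=
  sSup ((fun R1 : ℝ =>
    sSup {R2 : ℝ | (R1, R2) ∈ capRegion n11 n22 n12 n21 l11 l22} -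
    sSup {R2 : ℝ | (R1, R2) ∈ capRegion n11 n22 n12 n21 0 0}) '' {R1 : ℝ | 0 < R1})

/-- Maximum sum-rate improvement `Σ` due to feedback. -/
def SigmaImp (n11 n22 n12 n21 l11 l22 : ℕ) : ℝ :=
  sSup ((fun p : ℝ × ℝ => p.1 + p.2) '' capRegion n11 n22 n12 n21 l11 l22) -
  sSup ((fun p : ℝ × ℝ => p.1 + p.2) '' capRegion n11 n22 n12 n21 0 0)

lemma pp_nonneg (x : ℤ) : 0 ≤ pp x := le_max_right x 0

lemma pp_of_nonneg {x : ℤ} (hx : 0 ≤ x) : pp x = x := max_eq_left hx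

lemma pp_of_nonpos {x : ℤ} (hx : x ≤ 0) : pp x = 0 := max_eq_right hx

lemma corr_nonneg (njj nji nij ljj : ℤ) : 0 ≤ corr njj nji nij ljj := pp_nonneg _

/-- The greatest sum-rate of the channel `(10, 20, 6, 12)` is `20`, attained at `(0, 20)`. -/
lemma isGreatest_sumRate (l11 l22 : ℕ) :
    IsGreatest ((fun p : ℝ × ℝ => p.1 + p.2) '' capRegion 10 20 6 12 l11 l22) 20 := by
  constructor
  · have h1 : (0 : ℝ) ≤ corr 10 6 12 l11 := by exact_mod_cast corr_nonneg _ _ _ _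
    have h2 : (0 : ℝ) ≤ corr 20 12 6 l22 := by exact_mod_cast corr_nonneg _ _ _ _
    refine ⟨(0, 20), ?_, by norm_num⟩
    simp only [capRegion, Set.mem_ofPred_eq]
    norm_num [pp_of_nonneg, pp_of_nonpos]
    exact ⟨by linarith, by linarith, corr_nonneg _ _ _ _⟩
  · rintro _ ⟨p, hp, rfl⟩
    obtain ⟨-, -, -, -, -, -, h, -⟩ := hp
    norm_num [pp_of_nonneg, pp_of_nonpos] at h
    exact h

/-- for n11 = 10, n22 = 20, n12 = 6, n21 = 12, feedback never
increases the sum-rate. -/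
theorem sigma_example3 : ∀ l11 l22 : ℕ, SigmaImp 10 20 6 12 l11 l22 = 0 := by
  intro l11 l22
  rw [SigmaImp, (isGreatest_sumRate l11 l22).csSup_eq, (isGreatest_sumRate 0 0).csSup_eq, sub_self]

end
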